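/- Assume the nodes obey the density function w, each φ_n is twice continuously differentiable on [-1,1] with φ_n''(x) ≥ M for a constant M independent of n, the nodes satisfy a_1 n^{-b_1} ≤ x_i^{(n)} - x_{i-1}^{(n)} ≤ a_2 n^{-b_2} for all i and n (with a_1, a_2 > 0), and |φ_n'(x)| < M_2 · log n for all x ∈ (-1 + a_1 n^{-b_1-1}, 1 - a_1 n^{-b_1-1}). Then for all sufficiently large n, every inter-potential point satisfies ζ_i^{(n)} ∈ (x_{i-1}^{(n)} + a_1 n^{-b_1-1}, x_i^{(n)} - a_1 n^{-b_1-1}) for each i = 1,...,n. -/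

import Mathlib

open Filter Finset Set

noncomputable def discretePotential (X : ℕ → ℕ → ℝ) (φ : ℕ → ℝ → ℝ) (n : ℕ) (x : ℝ) : ℝ :=
  (1 / (n + 1 : ℝ)) * ∑ i ∈ Finset.range (n + 1), Real.log (1 / |x - X n i|) + φ n x

noncomputable def continuousPotential (w : ℝ → ℝ) (φ : ℝ → ℝ) (x : ℝ) : ℝ :=
  (∫ t in (-1 : ℝ)..1, Real.log (1 / |x - t|) * w t) + φ x

noncomputable def baryWeight (X : ℕ → ℕ → ℝ) (φ : ℕ → ℝ → ℝ) (n i : ℕ) : ℝ :=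
  Real.exp ((n + 1 : ℝ) * φ n (X n i)) / ∏ k ∈ (Finset.range (n + 1)).erase i, |X n i - X n k|

noncomputable def lagrangeBasis (X : ℕ → ℕ → ℝ) (φ : ℕ → ℝ → ℝ) (n k : ℕ) (x : ℝ) : ℝ :=
  ((∏ i ∈ (Finset.range (n + 1)).erase k, (x - X n i)) /
      (∏ i ∈ (Finset.range (n + 1)).erase k, (X n k - X n i))) *
    Real.exp ((n + 1 : ℝ) * (φ n (X n k) - φ n x))

noncomputable def lebesgueFun (X : ℕ → ℕ → ℝ) (φ : ℕ → ℝ → ℝ) (n : ℕ) (x : ℝ) : ℝ :=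
  ∑ k ∈ Finset.range (n + 1), |lagrangeBasis X φ n k x|

def ObeysDensity (X : ℕ → ℕ → ℝ) (w : ℝ → ℝ) : Prop :=
  ∀ a b : ℝ, -1 ≤ a → a ≤ b → b ≤ 1 →
    Filter.Tendsto
      (fun n : ℕ =>
        (((Finset.range (n + 1)).filter fun i => a ≤ X n i ∧ X n i ≤ b).card : ℝ) / (n + 1))
      Filter.atTop (nhds (∫ t in a..b, w t))

/-- Consecutive gaps of size at least `h` add up. -/
theorem mul_le_sub_of_le_gap {x : ℕ → ℝ} {n : ℕ} {h : ℝ}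
    (hgap : ∀ k < n, h ≤ x (k + 1) - x k) (j m : ℕ) (hjm : j + m ≤ n) :
    m * h ≤ x (j + m) - x j := by
  induction m with
  | zero => simp
  | succ m ih =>
    have h1 := ih (by omega)
    have h2 := hgap (j + m) (by omega)
    rw [← add_assoc]
    push_cast
    linarith

/-- Just to the right of a node, the sum `∑ 1 / (z - x k)` is dominated by that node. -/
theorem le_sum_one_div_sub {x : ℕ → ℝ} {n j : ℕ} {h z : ℝ} (hn : 2 ≤ n) (hj : j < n)
    (hh : 0 < h) (hgap : ∀ k < n, h ≤ x (k + 1) - x k) (hz : x j < z) (hz' : z ≤ x j + h / n) :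
    (n - 2 - 2 * Real.log n) / h ≤ ∑ k ∈ Finset.range (n + 1), 1 / (z - x k) := by
  have hn' : (2 : ℝ) ≤ n := by exact_mod_cast hn
  have hhn : h / n ≤ h / 2 := by gcongr
  have hleft : 0 ≤ ∑ k ∈ Finset.range j, 1 / (z - x k) := by
    refine Finset.sum_nonneg fun k hk => ?_
    have hk := Finset.mem_range.1 hk
    have h1 := mul_le_sub_of_le_gap hgap k (j - k) (by omega)
    rw [Nat.add_sub_cancel' hk.le] at h1
    have h2 : 0 ≤ ((j - k : ℕ) : ℝ) * h := by positivity
    exact one_div_nonneg.2 (by linarith)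
  have hmid : n / h ≤ 1 / (z - x j) := by
    rw [← one_div_div]
    exact one_div_le_one_div_of_le (by linarith) (by linarith)
  have hright : -(2 / h * (1 + Real.log n)) ≤
      ∑ m ∈ Finset.range (n - j), 1 / (z - x (j + 1 + m)) := by
    calc -(2 / h * (1 + Real.log n))
        ≤ -(2 / h * ∑ m ∈ Finset.range n, ((m : ℝ) + 1)⁻¹) := by
          have h1 := harmonic_le_one_add_log n
          simp only [harmonic, Rat.cast_sum, Rat.cast_inv, Nat.cast_add,
            Nat.cast_one] at h1
          push_cast at h1
          gcongr
      _ ≤ -(2 / h * ∑ m ∈ Finset.range (n - j), ((m : ℝ) + 1)⁻¹) := by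
          have h1 : ∑ m ∈ Finset.range (n - j), ((m : ℝ) + 1)⁻¹ ≤
              ∑ m ∈ Finset.range n, ((m : ℝ) + 1)⁻¹ :=
            Finset.sum_le_sum_of_subset_of_nonneg (Finset.range_mono (Nat.sub_le n j))
              fun _ _ _ => by positivity
          gcongr
      _ ≤ _ := by
          rw [Finset.mul_sum, ← Finset.sum_neg_distrib]
          refine Finset.sum_le_sum fun m hm => ?_
          have hm := Finset.mem_range.1 hm
          have h1 := mul_le_sub_of_le_gap hgap j (m + 1) (by omega)
          rw [show j + (m + 1) = j + 1 + m by ring] at h1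
          push_cast at h1
          have h2 : 0 ≤ (m : ℝ) * h := by positivity
          have h3 : ((m : ℝ) + 1) * h / 2 ≤ x (j + 1 + m) - z := by linarith
          have h4 := one_div_le_one_div_of_le (by positivity) h3
          rw [← neg_sub (x (j + 1 + m)) z, one_div_neg_eq_neg_one_div, neg_le_neg_iff]
          refine h4.trans (le_of_eq ?_)
          field_simp
  have hsplit : n + 1 = j + 1 + (n - j) := by omega
  rw [hsplit, Finset.sum_range_add, Finset.sum_range_succ]
  have h5 : (n - 2 - 2 * Real.log n) / h = n / h + -(2 / h * (1 + Real.log n)) := by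
    field_simp
    ring
  linarith

theorem lt_sum_one_div_sub {x : ℕ → ℝ} {n j : ℕ} {h z K : ℝ} (hn : 2 ≤ n) (hj : j < n)
    (hh : 0 < h) (hgap : ∀ k < n, h ≤ x (k + 1) - x k) (hz : x j < z) (hz' : z ≤ x j + h / n)
    (hhn : n * h ≤ 2) (hK : 0 ≤ K) (hlog : 4 * K < n - 2 - 2 * Real.log n) :
    (n + 1) * K < ∑ k ∈ Finset.range (n + 1), 1 / (z - x k) := by
  refine lt_of_lt_of_le ?_ (le_sum_one_div_sub hn hj hh hgap hz hz')
  have hn' : (2 : ℝ) ≤ n := by exact_mod_cast hn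
  rw [lt_div_iff₀ hh]
  nlinarith [mul_nonneg hK hh.le, mul_le_mul_of_nonneg_left hhn hK]

/-- Just to the left of a node, by reflecting `lt_sum_one_div_sub`. -/
theorem sum_one_div_sub_lt {x : ℕ → ℝ} {n j : ℕ} {h z K : ℝ} (hn : 2 ≤ n) (hj : j < n)
    (hh : 0 < h) (hgap : ∀ k < n, h ≤ x (k + 1) - x k) (hz : z < x (j + 1))
    (hz' : x (j + 1) - h / n ≤ z)
    (hhn : n * h ≤ 2) (hK : 0 ≤ K) (hlog : 4 * K < n - 2 - 2 * Real.log n) :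
    ∑ k ∈ Finset.range (n + 1), 1 / (z - x k) < -((n + 1) * K) := by
  have hnj : n - (n - 1 - j) = j + 1 := by omega
  have key := lt_sum_one_div_sub (x := fun k => -x (n - k)) (n := n) (j := n - 1 - j) (h := h)
    (z := -z) hn (by omega) hh
    (fun k hk => by
      have := hgap (n - (k + 1)) (by omega)
      rw [show n - (k + 1) + 1 = n - k by omega] at this
      linarith)
    (by simpa [hnj] using hz) (by simp only [hnj]; linarith) hhn hK hlog
  have hrefl := Finset.sum_range_reflect (fun k => 1 / (z - x k)) (n + 1)
  simp only [Nat.add_sub_cancel] at hrefl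
  have hneg : ∑ k ∈ Finset.range (n + 1), 1 / (-z - -x (n - k)) =
      -∑ k ∈ Finset.range (n + 1), 1 / (z - x (n - k)) := by
    rw [← Finset.sum_neg_distrib]
    refine Finset.sum_congr rfl fun k _ => ?_
    rw [← one_div_neg_eq_neg_one_div]
    ring_nf
  linarith

theorem hasDerivAt_discretePotential {X : ℕ → ℕ → ℝ} {φ : ℕ → ℝ → ℝ} {n : ℕ} {z d : ℝ}
    (hz : ∀ k ∈ Finset.range (n + 1), z ≠ X n k) (hφ : HasDerivAt (φ n) d z) :
    HasDerivAt (discretePotential X φ n)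
      ((1 / (n + 1 : ℝ)) * ∑ k ∈ Finset.range (n + 1), -(1 / (z - X n k)) + d) z := by
  unfold discretePotential
  refine (HasDerivAt.const_mul _ (HasDerivAt.fun_sum fun k hk => ?_)).add hφ
  have h1 := (((hasDerivAt_id z).sub_const (X n k)).log (sub_ne_zero.2 (hz k hk))).neg
  simpa [one_div, Real.log_inv, Real.log_abs, Function.comp_def, Pi.neg_def] using h1

theorem sum_one_div_sub_eq_of_deriv_eq_zero {X : ℕ → ℕ → ℝ} {φ : ℕ → ℝ → ℝ} {n : ℕ} {z d : ℝ}
    (hz : ∀ k ∈ Finset.range (n + 1), z ≠ X n k) (hφ : HasDerivAt (φ n) d z)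
    (hcrit : deriv (discretePotential X φ n) z = 0) :
    ∑ k ∈ Finset.range (n + 1), 1 / (z - X n k) = (n + 1) * d := by
  rw [(hasDerivAt_discretePotential hz hφ).deriv, Finset.sum_neg_distrib] at hcrit
  have hn : (n + 1 : ℝ) ≠ 0 := by positivity
  field_simp at hcrit
  simp only [one_div]
  simp only [one_div] at hcrit
  linarith

/-- The first derivative grows at least linearly when the second one is bounded below. -/
theorem mul_sub_le_sub_of_le_deriv {f f' : ℝ → ℝ} {M u v : ℝ}
    (hf : ∀ x ∈ Set.Icc (-1 : ℝ) 1, HasDerivAt f (f' x) x)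
    (hM : ∀ x ∈ Set.Icc (-1 : ℝ) 1, M ≤ f' x)
    (hu : u ∈ Set.Icc (-1 : ℝ) 1) (hv : v ∈ Set.Icc (-1 : ℝ) 1) (huv : u ≤ v) :
    M * (v - u) ≤ f v - f u :=
  (convex_Icc (-1 : ℝ) 1).mul_sub_le_image_sub_of_le_deriv
    (fun x hx => (hf x hx).continuousAt.continuousWithinAt)
    (fun x hx => (hf x (interior_subset hx)).differentiableAt.differentiableWithinAt)
    (fun x hx => by
      rw [(hf x (interior_subset hx)).deriv]
      exact hM x (interior_subset hx)) u hu v hv huv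

theorem eventually_add_mul_log_lt (A B : ℝ) :
    ∀ᶠ n : ℕ in atTop, A + B * Real.log n < n := by
  have h1 : (fun x : ℝ => A + B * Real.log x) =o[atTop] (fun x : ℝ => x) :=
    (Asymptotics.isLittleO_const_id_atTop A).add (Real.isLittleO_log_id_atTop.const_mul_left B)
  have h2 := tendsto_natCast_atTop_atTop (R := ℝ) |>.eventually (h1.bound (c := 1 / 2) (by norm_num))
  filter_upwards [h2, eventually_gt_atTop 0] with n hn hn0
  have hn0 : (0 : ℝ) < n := by exact_mod_cast hn0
  rw [Real.norm_eq_abs, Real.norm_of_nonneg hn0.le] at hn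
  linarith [le_abs_self (A + B * Real.log n)]

theorem stmt_3 (X : ℕ → ℕ → ℝ) (w : ℝ → ℝ) (φ φ' φ'' : ℕ → ℝ → ℝ)
    (M M₂ a₁ a₂ b₁ b₂ : ℝ) (ζ : ℕ → ℕ → ℝ)
    (hXorder : ∀ n, 1 ≤ n → ∀ i j : ℕ, i < j → j ≤ n → X n i < X n j)
    (hXmem : ∀ n, 1 ≤ n → ∀ i, i ≤ n → X n i ∈ Set.Icc (-1 : ℝ) 1)
    (hw_cont : ContinuousOn w (Set.Icc (-1 : ℝ) 1))
    (hw_pos : ∀ t ∈ Set.Icc (-1 : ℝ) 1, 0 < w t)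
    (hw_int : (∫ t in (-1 : ℝ)..1, w t) = 1)
    (hobeys : ObeysDensity X w)
    (hφd1 : ∀ n, ∀ x ∈ Set.Icc (-1 : ℝ) 1, HasDerivAt (φ n) (φ' n x) x)
    (hφd2 : ∀ n, ∀ x ∈ Set.Icc (-1 : ℝ) 1, HasDerivAt (φ' n) (φ'' n x) x)
    (hφ''cont : ∀ n, ContinuousOn (φ'' n) (Set.Icc (-1 : ℝ) 1))
    (hM : ∀ n, ∀ x ∈ Set.Icc (-1 : ℝ) 1, M ≤ φ'' n x)
    (ha₁ : 0 < a₁) (ha₂ : 0 < a₂)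
    (hgap : ∀ n : ℕ, 1 ≤ n → ∀ i, 1 ≤ i → i ≤ n →
      a₁ * (n : ℝ) ^ (-b₁) ≤ X n i - X n (i - 1) ∧ X n i - X n (i - 1) ≤ a₂ * (n : ℝ) ^ (-b₂))
    (hφ'bd : ∀ n : ℕ, 1 ≤ n →
      ∀ x ∈ Set.Ioo (-1 + a₁ * (n : ℝ) ^ (-b₁ - 1)) (1 - a₁ * (n : ℝ) ^ (-b₁ - 1)),
        |φ' n x| < M₂ * Real.log n)
    (hζmem : ∀ n : ℕ, 1 ≤ n → ∀ i, 1 ≤ i → i ≤ n → ζ n i ∈ Set.Ioo (X n (i - 1)) (X n i))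
    (hζcrit : ∀ n : ℕ, 1 ≤ n → ∀ i, 1 ≤ i → i ≤ n → deriv (discretePotential X φ n) (ζ n i) = 0) :
    ∃ N : ℕ, ∀ n : ℕ, N ≤ n → ∀ i, 1 ≤ i → i ≤ n →
      ζ n i ∈ Set.Ioo (X n (i - 1) + a₁ * (n : ℝ) ^ (-b₁ - 1))
        (X n i - a₁ * (n : ℝ) ^ (-b₁ - 1)) := by
  obtain ⟨N, hN⟩ := eventually_atTop.1
    (eventually_add_mul_log_lt (2 + 4 * |M|) (2 + 4 * |M₂|))
  refine ⟨max N 3, fun n hn i hi1 hin => ?_⟩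
  have hn3 : 3 ≤ n := (le_max_right _ _).trans hn
  have hn1 : 1 ≤ n := by omega
  have hn3' : (3 : ℝ) ≤ n := by exact_mod_cast hn3
  have hn0 : (0 : ℝ) < n := by linarith
  obtain ⟨j, rfl⟩ : ∃ j, i = j + 1 := ⟨i - 1, by omega⟩
  have hlog0 : 0 ≤ Real.log n := Real.log_nonneg (by linarith)
  set h : ℝ := a₁ * (n : ℝ) ^ (-b₁) with hh_def
  have hh : 0 < h := by positivity
  have hδ : a₁ * (n : ℝ) ^ (-b₁ - 1) = h / n := by
    rw [Real.rpow_sub_one hn0.ne', hh_def, mul_div_assoc]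
  have hbd := hφ'bd n hn1
  rw [hδ] at hbd ⊢
  have hgap' : ∀ k < n, h ≤ X n (k + 1) - X n k := fun k hk => by
    simpa using (hgap n hn1 (k + 1) (by omega) (by omega)).1
  have hhn : n * h ≤ 2 := by
    have h1 := mul_le_sub_of_le_gap hgap' 0 n (by omega)
    rw [zero_add] at h1
    linarith [(hXmem n hn1 n le_rfl).2, (hXmem n hn1 0 (by omega)).1]
  have hδpos : 0 < h / n := by positivity
  have hδ3 : 3 * (h / n) ≤ h := by
    rw [← mul_div_assoc, div_le_iff₀ hn0]
    nlinarith
  have hδ1 : h / n < 1 := by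
    have : 3 * h ≤ n * h := by gcongr
    linarith
  obtain ⟨hζl, hζr⟩ := hζmem n hn1 (j + 1) hi1 hin
  have hζd := hζcrit n hn1 (j + 1) hi1 hin
  set z := ζ n (j + 1)
  simp only [Nat.add_sub_cancel] at hζl ⊢
  have hXl := (hXmem n hn1 j (by omega)).1
  have hXr := (hXmem n hn1 (j + 1) hin).2
  have hz : z ∈ Set.Icc (-1 : ℝ) 1 := ⟨by linarith, by linarith⟩
  have hzX : ∀ k ∈ Finset.range (n + 1), z ≠ X n k := by
    intro k hk
    have hk := Finset.mem_range.1 hk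
    rcases le_or_gt k j with hkj | hkj
    · rcases hkj.eq_or_lt with rfl | hlt
      · exact hζl.ne'
      · exact ((hXorder n hn1 k j hlt (by omega)).trans hζl).ne'
    · rcases (Nat.succ_le_of_lt hkj).eq_or_lt with heq | hlt
      · exact heq ▸ hζr.ne
      · exact (hζr.trans (hXorder n hn1 (j + 1) k hlt (by omega))).ne
  have hsum := sum_one_div_sub_eq_of_deriv_eq_zero hzX (hφd1 n z hz) hζd
  set K : ℝ := |M₂| * Real.log n + |M| with hK_def
  have hK : 0 ≤ K := by positivity
  have hlog : 4 * K < n - 2 - 2 * Real.log n := by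
    have := hN n ((le_max_left _ _).trans hn)
    rw [hK_def]
    linarith
  have hM₂ : M₂ * Real.log n ≤ |M₂| * Real.log n := by gcongr; exact le_abs_self _
  have hzero : (0 : ℝ) ∈ Set.Icc (-1 : ℝ) 1 := by norm_num
  have hbd0 := abs_lt.1 (hbd 0 ⟨by linarith, by linarith⟩)
  have hg := hgap' j (by omega)
  constructor
  · by_contra! hcon
    have hφK : φ' n z ≤ K := by
      rcases lt_or_ge (-1 + h / n) z with hzin | hzout
      · have := abs_lt.1 (hbd z ⟨hzin, by linarith⟩)
        linarith [abs_nonneg M]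
      · have h1 := mul_sub_le_sub_of_le_deriv (hφd2 n) (hM n) hz hzero (by linarith)
        have h2 : -|M| ≤ M * (0 - z) := by
          nlinarith [neg_abs_le M, abs_nonneg M, hz.1]
        linarith
    have := lt_sum_one_div_sub (by omega) (by omega) hh hgap' hζl hcon hhn hK hlog
    rw [hsum] at this
    exact absurd (lt_of_mul_lt_mul_left this (by positivity)) hφK.not_gt
  · by_contra! hcon
    have hφK : -K ≤ φ' n z := by
      rcases lt_or_ge z (1 - h / n) with hzin | hzout
      · have := abs_lt.1 (hbd z ⟨by linarith, hzin⟩)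
        linarith [abs_nonneg M]
      · have h1 := mul_sub_le_sub_of_le_deriv (hφd2 n) (hM n) hzero hz (by linarith)
        have h2 : -|M| ≤ M * (z - 0) := by
          nlinarith [neg_abs_le M, abs_nonneg M, hz.2]
        linarith
    have := sum_one_div_sub_lt (by omega) (by omega) hh hgap' hζr hcon hhn hK hlog
    rw [hsum, ← mul_neg] at this
    exact absurd (lt_of_mul_lt_mul_left this (by positivity)) hφK.not_gt
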